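/- Let K be a finite simple graph with at least one edge such that for every edge xy of K, the graph K − x − y is a cycle on n ≥ 3 vertices. Then K has at most 6 vertices; equivalently, for no edge xy of K is the graph K − x − y a cycle on n ≥ 5 vertices. -/

import Mathlib

open SimpleGraph

/-- The vertex set of the induced subgraph `K − x − y`. -/
def delTwo {V : Type*} (x y : V) : Set V := {v | v ≠ x ∧ v ≠ y}

/-- `G` has a θ-subgraph with all vertices inside the set `s`: two distinct vertices
`u, v ∈ s` joined by three distinct paths lying in `s` which pairwise have no common
vertices other than `u` and `v`. -/
def HasThetaIn {V : Type*} (G : SimpleGraph V) (s : Set V) : Prop :=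
  ∃ (u v : V) (p q r : G.Walk u v),
    u ∈ s ∧ v ∈ s ∧ u ≠ v ∧
    p.IsPath ∧ q.IsPath ∧ r.IsPath ∧
    p ≠ q ∧ p ≠ r ∧ q ≠ r ∧
    (∀ w ∈ p.support, w ∈ s) ∧ (∀ w ∈ q.support, w ∈ s) ∧ (∀ w ∈ r.support, w ∈ s) ∧
    (∀ w, w ∈ p.support → w ∈ q.support → w = u ∨ w = v) ∧
    (∀ w, w ∈ p.support → w ∈ r.support → w = u ∨ w = v) ∧
    (∀ w, w ∈ q.support → w ∈ r.support → w = u ∨ w = v)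

/-- `G` has a θ-subgraph. -/
def HasTheta {V : Type*} (G : SimpleGraph V) : Prop := HasThetaIn G Set.univ

/-- The subgraph of `G` induced on the vertex set `s` is a cycle on `n ≥ 3` vertices:
it has `n ≥ 3` vertices, is connected, and each of its vertices has exactly two
neighbors in it. -/
def IsCycleSetOn {V : Type*} (G : SimpleGraph V) (s : Set V) (n : ℕ) : Prop :=
  3 ≤ n ∧ s.ncard = n ∧ (G.induce s).Connected ∧
  ∀ v ∈ s, ({w ∈ s | G.Adj v w}).ncard = 2

section EdgeDeletion

variable {V : Type*} [Fintype V]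

theorem sum_filter_ne_ne [DecidableEq V] {x y : V} (hxy : x ≠ y) (f : V → ℤ) :
    ∑ v with v ≠ x ∧ v ≠ y, f v = ∑ v, f v - f x - f y := by
  have hf : (Finset.univ.filter fun v => v ≠ x ∧ v ≠ y) = (Finset.univ.erase x).erase y := by
    ext v
    simp [and_comm]
  rw [hf, Finset.sum_erase_eq_sub (by simp [hxy.symm]), Finset.sum_erase_eq_sub (by simp)]

variable (K : SimpleGraph V) [DecidableRel K.Adj]

theorem sum_adjMatrix_row (v : V) : ∑ w, K.adjMatrix ℤ v w = K.degree v := by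
  simp [adjMatrix_apply, card_neighborFinset_eq_degree,
    ← neighborFinset_eq_filter]

theorem sum_adjMatrix_col (v : V) : ∑ w, K.adjMatrix ℤ w v = K.degree v := by
  simp_rw [← sum_adjMatrix_row K v, K.isSymm_adjMatrix.apply]

variable {K}

/-- If deleting the ends of any edge leaves a `2`-regular graph, then the degree sum of the two
ends does not depend on the edge. -/
theorem two_mul_degree_add_degree [DecidableEq V]
    (hK : ∀ x y, K.Adj x y → ∀ v, v ≠ x → v ≠ y →
      ∑ w with w ≠ x ∧ w ≠ y, K.adjMatrix ℤ v w = 2)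
    {x y : V} (hxy : K.Adj x y) :
    2 * ((K.degree x : ℤ) + K.degree y) =
      ∑ v, (K.degree v : ℤ) - 2 * Fintype.card V + 6 := by
  have hv : ∑ v with v ≠ x ∧ v ≠ y, ((K.degree v : ℤ) - K.adjMatrix ℤ v x - K.adjMatrix ℤ v y) =
      ∑ v with v ≠ x ∧ v ≠ y, 2 := by
    refine Finset.sum_congr rfl fun v hv => ?_
    simp only [Finset.mem_filter, Finset.mem_univ, true_and] at hv
    rw [← hK x y hxy v hv.1 hv.2, sum_filter_ne_ne hxy.ne, sum_adjMatrix_row]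
  rw [sum_filter_ne_ne hxy.ne, sum_filter_ne_ne hxy.ne, Finset.sum_sub_distrib,
    Finset.sum_sub_distrib, sum_adjMatrix_col, sum_adjMatrix_col] at hv
  simp [adjMatrix_apply, hxy, hxy.symm] at hv
  linarith

/-- Weighting each ordered pair of adjacent vertices in `s` by its degree sum. -/
theorem sum_sum_adjMatrix_mul_degree_add (s : Finset V) :
    ∑ v ∈ s, ∑ w ∈ s, K.adjMatrix ℤ v w * (2 * ((K.degree v : ℤ) + K.degree w)) =
      4 * ∑ v ∈ s, K.degree v * ∑ w ∈ s, K.adjMatrix ℤ v w := by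
  have hsymm : ∑ v ∈ s, ∑ w ∈ s, K.adjMatrix ℤ v w * (K.degree w : ℤ) =
      ∑ v ∈ s, ∑ w ∈ s, K.adjMatrix ℤ v w * (K.degree v : ℤ) := by
    rw [Finset.sum_comm]
    simp_rw [K.isSymm_adjMatrix.apply]
  calc ∑ v ∈ s, ∑ w ∈ s, K.adjMatrix ℤ v w * (2 * ((K.degree v : ℤ) + K.degree w))
      = 2 * (∑ v ∈ s, ∑ w ∈ s, K.adjMatrix ℤ v w * (K.degree v : ℤ)) +
        2 * ∑ v ∈ s, ∑ w ∈ s, K.adjMatrix ℤ v w * (K.degree w : ℤ) := by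
        simp_rw [Finset.mul_sum, ← Finset.sum_add_distrib]
        exact Finset.sum_congr rfl fun v _ => Finset.sum_congr rfl fun w _ => by ring
    _ = 4 * ∑ v ∈ s, K.degree v * ∑ w ∈ s, K.adjMatrix ℤ v w := by
        rw [hsymm, ← add_mul]
        simp_rw [Finset.mul_sum]
        exact Finset.sum_congr rfl fun v _ => Finset.sum_congr rfl fun w _ => by ring

theorem sum_degree_mul_eq_of_degree_add_eq {t : ℤ}
    (ht : ∀ x y, K.Adj x y → 2 * ((K.degree x : ℤ) + K.degree y) = t) (s : Finset V) :
    4 * ∑ v ∈ s, K.degree v * ∑ w ∈ s, K.adjMatrix ℤ v w =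
      t * ∑ v ∈ s, ∑ w ∈ s, K.adjMatrix ℤ v w := by
  rw [← sum_sum_adjMatrix_mul_degree_add]
  simp_rw [Finset.mul_sum]
  refine Finset.sum_congr rfl fun v _ => Finset.sum_congr rfl fun w _ => ?_
  by_cases hvw : K.Adj v w
  · simp [adjMatrix_apply, hvw, ht v w hvw]
  · simp [adjMatrix_apply, hvw]

/-- A graph in which deleting the ends of any edge leaves a `2`-regular graph has at most six
vertices, as it is regular. -/
theorem card_le_six_of_two_regular [DecidableEq V]
    (hK : ∀ x y, K.Adj x y → ∀ v, v ≠ x → v ≠ y →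
      ∑ w with w ≠ x ∧ w ≠ y, K.adjMatrix ℤ v w = 2)
    {x y : V} (hxy : K.Adj x y) : Fintype.card V ≤ 6 := by
  obtain ⟨t, ht⟩ : ∃ t, t = ∑ v, (K.degree v : ℤ) - 2 * Fintype.card V + 6 := ⟨_, rfl⟩
  have hadj : ∀ x y, K.Adj x y → 2 * ((K.degree x : ℤ) + K.degree y) = t :=
    fun _ _ hadj => ht ▸ two_mul_degree_add_degree hK hadj
  have hsq := sum_degree_mul_eq_of_degree_add_eq hadj Finset.univ
  have hlin := sum_degree_mul_eq_of_degree_add_eq hadj ({v | v ≠ x ∧ v ≠ y} : Finset V)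
  have hcycle : ∀ v ∈ ({v | v ≠ x ∧ v ≠ y} : Finset V),
      ∑ w with w ≠ x ∧ w ≠ y, K.adjMatrix ℤ v w = 2 := by
    intro v hv
    simp only [Finset.mem_filter, Finset.mem_univ, true_and] at hv
    exact hK x y hxy v hv.1 hv.2
  rw [Finset.sum_congr rfl hcycle,
    Finset.sum_congr rfl fun v hv => congrArg ((K.degree v : ℤ) * ·) (hcycle v hv),
    sum_filter_ne_ne hxy.ne, sum_filter_ne_ne hxy.ne, ← Finset.sum_mul] at hlin
  simp only [Finset.sum_const, Finset.card_univ, nsmul_eq_mul] at hlin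
  simp_rw [sum_adjMatrix_row] at hsq
  have hxyt := hadj x y hxy
  have hmean : 4 * ∑ v, (K.degree v : ℤ) = t * Fintype.card V := by linarith
  have hvar : ∑ v, (4 * (K.degree v : ℤ) - t) ^ 2 = 0 := by
    have hexp : ∀ v, (4 * (K.degree v : ℤ) - t) ^ 2 =
        16 * (K.degree v * K.degree v) - 8 * t * K.degree v + t ^ 2 := fun v => by ring
    simp_rw [hexp, Finset.sum_add_distrib, Finset.sum_sub_distrib, ← Finset.mul_sum]
    simp only [Finset.sum_const, Finset.card_univ, nsmul_eq_mul]
    linear_combination 4 * hsq - t * hmean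
  have hx : (4 * (K.degree x : ℤ) - t) ^ 2 = 0 :=
    (Finset.sum_eq_zero_iff_of_nonneg fun v _ => sq_nonneg _).1 hvar x (Finset.mem_univ x)
  have hreg : t = 4 * (K.degree x : ℤ) := by
    have := pow_eq_zero_iff (two_ne_zero) |>.1 hx
    linarith
  have hprod : ((K.degree x : ℤ) - 2) * ((Fintype.card V : ℤ) - 4) = 2 := by
    rw [hreg] at ht hmean
    linarith
  have hdvd : (Fintype.card V : ℤ) - 4 ∣ 2 := Dvd.intro_left _ hprod
  have := Int.le_of_dvd two_pos hdvd
  omega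

end EdgeDeletion

theorem IsCycleSetOn.sum_adjMatrix {V : Type*} [Fintype V] [DecidableEq V] {K : SimpleGraph V}
    [DecidableRel K.Adj] {x y v : V} {n : ℕ} (h : IsCycleSetOn K (delTwo x y) n)
    (hvx : v ≠ x) (hvy : v ≠ y) :
    ∑ w with w ≠ x ∧ w ≠ y, K.adjMatrix ℤ v w = 2 := by
  have hcard := h.2.2.2 v ⟨hvx, hvy⟩
  have hset : {w ∈ delTwo x y | K.Adj v w} =
      (({w | (w ≠ x ∧ w ≠ y) ∧ K.Adj v w} : Finset V) : Set V) := by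
    ext w
    simp [delTwo]
  rw [hset, Set.ncard_coe_finset] at hcard
  simp only [adjMatrix_apply, Finset.sum_boole, Finset.filter_filter]
  exact_mod_cast hcard

theorem ncard_delTwo {V : Type*} [Fintype V] {x y : V} (hxy : x ≠ y) :
    (delTwo x y).ncard + 2 = Fintype.card V := by
  have hcompl : delTwo x y = ({x, y} : Set V)ᶜ := by
    ext v
    simp [delTwo]
  rw [hcompl, ← Set.ncard_pair hxy, add_comm, Set.ncard_add_ncard_compl,
    Nat.card_eq_fintype_card]

/-- If `K` is a finite simple graph with at least one edge such that for every edge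
`xy` the graph `K − x − y` is a cycle on `n ≥ 3` vertices, then `K` has at most `6`
vertices; equivalently, for no edge `xy` of `K` is `K − x − y` a cycle on `n ≥ 5`
vertices. -/
theorem stmt_10 {V : Type*} [Fintype V] (K : SimpleGraph V)
    (hedge : ∃ x y, K.Adj x y)
    (h : ∀ x y, K.Adj x y → ∃ n, IsCycleSetOn K (delTwo x y) n) :
    Fintype.card V ≤ 6 ∧
    ∀ x y, K.Adj x y → ∀ n, 5 ≤ n → ¬ IsCycleSetOn K (delTwo x y) n := by
  classical
  obtain ⟨a, b, hab⟩ := hedge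
  have hcard : Fintype.card V ≤ 6 := card_le_six_of_two_regular
    (fun x y hxy v hvx hvy => (h x y hxy).choose_spec.sum_adjMatrix hvx hvy) hab
  refine ⟨hcard, fun x y hxy n hn hcycle => ?_⟩
  have := ncard_delTwo hxy.ne
  have := hcycle.2.1
  omega
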